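/- Let G, A, B, C, f be as above with L(A,B) := Σ_{v∈B} Δ_G f(v) < ∞, and fix x ∈ C with f(x) > 0. Then there is a unique bounded function g on V with g ≡ 1 on A, g ≡ 0 on B, Δ_G g ≡ 0 on C \ {x}, and Σ_{v∈A} Δ_G g(v) = 0. Moreover this g is non-negative, satisfies Σ_{v∈B∪{x}} Δ_G g(v) = 0, and Δ_G g(x) = −L(A,B)/f(x). -/

import Mathlib

open Filter

/-- The weight `P₀(γ) = 1/∏_{j=0}^{n-1} deg(γⱼ)` of a walk `γ = (γ₀,…,γₙ)`
(product of reciprocal degrees over all vertices except the last). -/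
noncomputable def walkWeight {V : Type*} (G : SimpleGraph V) [G.LocallyFinite]
    {v w : V} (γ : G.Walk v w) : ℝ :=
  (γ.support.dropLast.map fun u => ((G.degree u : ℝ))⁻¹).prod

/-- The probability that the simple random walk on `G` started at `v` hits `A`
before `B`: the sum of the weights of all walk trajectories from `v` ending at a
vertex of `A`, all of whose other vertices avoid `A ∪ B`. -/
noncomputable def hitBefore {V : Type*} (G : SimpleGraph V) [G.LocallyFinite]
    (A B : Set V) (v : V) : ℝ :=
  ∑' γ : (Σ a : A, {w : G.Walk v (a : V) // ∀ u ∈ w.support.dropLast, u ∉ A ∪ B}),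
    walkWeight G (γ.2 : G.Walk v (γ.1 : V))

/-- The graph Laplacian `Δ_G f(v) = Σ_{w∼v} (f(w) − f(v))`. -/
noncomputable def graphLap {V : Type*} (G : SimpleGraph V) [G.LocallyFinite]
    (f : V → ℝ) (v : V) : ℝ :=
  ∑ w ∈ G.neighborFinset v, (f w - f v)

namespace RW

open scoped ENNReal Classical

variable {V : Type*} (G : SimpleGraph V) [G.LocallyFinite]

noncomputable def cc (v : V) : ℝ≥0∞ := ENNReal.ofReal ((G.degree v : ℝ)⁻¹)

noncomputable def kap (S : Set V) (v : V) : ℝ≥0∞ := if v ∈ S then 0 else cc G v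

noncomputable def T (S : Set V) (φ : V → ℝ≥0∞) (v : V) : ℝ≥0∞ :=
  kap G S v * ∑ w ∈ G.neighborFinset v, φ w

noncomputable def eN (S A : Set V) : ℕ → V → ℝ≥0∞
  | 0 => fun v => if v ∈ A then 1 else 0
  | n + 1 => T G S (eN S A n)

noncomputable def kN (S : Set V) (x : V) : ℕ → V → ℝ≥0∞
  | 0 => fun v => if v = x then kap G S x else 0
  | n + 1 => T G S (kN S x n)

noncomputable def EE (S A : Set V) (v : V) : ℝ≥0∞ := ∑' n, eN G S A n v

noncomputable def Gr (S : Set V) (v x : V) : ℝ≥0∞ := ∑' n, kN G S x n v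

noncomputable def wt (S : Set V) : {v w : V} → G.Walk v w → ℝ≥0∞
  | _, _, .nil => 1
  | v, _, .cons _ p => kap G S v * wt S p

lemma wt_eq (S : Set V) {v w : V} (p : G.Walk v w) :
    wt G S p = if ∀ u ∈ p.support.dropLast, u ∉ S then ENNReal.ofReal (walkWeight G p) else 0 := by
  induction p with
  | nil => simp [wt, walkWeight]
  | @cons u v w h p ih =>
    have hs : (SimpleGraph.Walk.cons h p).support.dropLast = u :: p.support.dropLast := by
      rw [SimpleGraph.Walk.support_cons, List.dropLast_cons_of_ne_nil (by simp)]
    have hw : walkWeight G (SimpleGraph.Walk.cons h p) = (G.degree u : ℝ)⁻¹ * walkWeight G p := by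
      unfold walkWeight; rw [hs]; simp
    rw [wt, ih, hs, hw, ENNReal.ofReal_mul (by positivity)]
    simp only [kap, cc, List.mem_cons, forall_eq_or_imp]
    split_ifs <;> simp_all

def walkSuccEquiv (v a : V) (n : ℕ) :
    {p : G.Walk v a // p.length = n + 1} ≃
      Σ w : G.neighborSet v, {p : G.Walk (w : V) a // p.length = n} where
  toFun p := match p with
    | ⟨.cons (v := w) h p, hp⟩ => ⟨⟨w, h⟩, ⟨p, by simpa using hp⟩⟩
  invFun q := ⟨.cons ((G.mem_neighborSet v q.1.1).1 q.1.2) q.2.1,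
    (SimpleGraph.Walk.length_cons _ _).trans (congrArg (· + 1) q.2.2)⟩
  left_inv p := by
    rcases p with ⟨p, hp⟩
    cases p with
    | nil => simp at hp
    | cons h p => rfl
  right_inv q := rfl

lemma tsum_len (S : Set V) (n : ℕ) (v a : V) :
    ∑' p : {p : G.Walk v a // p.length = n}, wt G S p.1 = eN G S {a} n v := by
  induction n generalizing v with
  | zero =>
    by_cases h : v = a
    · subst h
      have : Unique {p : G.Walk v v // p.length = 0} :=
        { default := ⟨.nil, rfl⟩
          uniq := by
            rintro ⟨p, hp⟩
            cases p with
            | nil => rfl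
            | cons h p => simp at hp }
      rw [tsum_eq_single default (fun b hb => absurd (Subsingleton.elim b default) hb)]
      have h2 : (default : {p : G.Walk v v // p.length = 0}) = ⟨.nil, rfl⟩ := Subsingleton.elim _ _
      rw [h2]
      simp [wt, eN]
    · have : IsEmpty {p : G.Walk v a // p.length = 0} :=
        ⟨fun p => h (SimpleGraph.Walk.eq_of_length_eq_zero p.2)⟩
      simp [eN, h]
  | succ n ih =>
    rw [← (walkSuccEquiv G v a n).symm.tsum_eq, ENNReal.tsum_sigma']
    simp only [walkSuccEquiv, Equiv.coe_fn_symm_mk, wt, ENNReal.tsum_mul_left, ih]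
    rw [tsum_fintype, eN, T]
    congr 1
    rw [SimpleGraph.neighborFinset]
    exact Finset.sum_set_coe (f := fun i => eN G S {a} n i) (G.neighborSet v)

lemma tsum_walk (S : Set V) (v a : V) :
    ∑' p : G.Walk v a, wt G S p = EE G S {a} v := by
  rw [← (Equiv.sigmaFiberEquiv (fun p : G.Walk v a => p.length)).tsum_eq, ENNReal.tsum_sigma']
  unfold EE
  congr 1
  ext n
  exact tsum_len G S n v a

lemma T_tsum {ι : Type*} (S : Set V) (φ : ι → V → ℝ≥0∞) (v : V) :
    T G S (fun v => ∑' i, φ i v) v = ∑' i, T G S (φ i) v := by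
  unfold T
  rw [ENNReal.tsum_mul_left, Summable.tsum_finsetSum (fun _ _ => ENNReal.summable)]

lemma eN_tsum (S A : Set V) (n : ℕ) (v : V) :
    ∑' a : A, eN G S {(a : V)} n v = eN G S A n v := by
  induction n generalizing v with
  | zero =>
    simp only [eN, Set.mem_singleton_iff]
    rw [tsum_subtype A (fun a => if v = a then (1 : ℝ≥0∞) else 0), tsum_eq_single v]
    · simp [Set.indicator]
    · intro b hb
      simp [Set.indicator, hb.symm]
  | succ n ih =>
    simp only [eN]
    rw [← T_tsum]
    congr 1
    ext w
    exact ih w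

lemma hit_eq (A B : Set V) (v : V) : hitBefore G A B v = (EE G (A ∪ B) A v).toReal := by
  have h1 : EE G (A ∪ B) A v = ∑' γ : (Σ a : A, {w : G.Walk v (a : V) //
      ∀ u ∈ w.support.dropLast, u ∉ A ∪ B}),
      ENNReal.ofReal (walkWeight G (γ.2 : G.Walk v (γ.1 : V))) := by
    rw [ENNReal.tsum_sigma']
    have h5 : EE G (A ∪ B) A v = ∑' n, ∑' a : A, eN G (A ∪ B) {(a : V)} n v := by
      unfold EE
      congr 1
      ext n
      exact (eN_tsum G (A ∪ B) A n v).symm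
    rw [h5, ENNReal.tsum_comm]
    congr 1
    ext a
    have := tsum_walk G (A ∪ B) v a
    rw [EE] at this
    rw [← this]
    have h3 := tsum_subtype {w : G.Walk v (a : V) | ∀ u ∈ w.support.dropLast, u ∉ A ∪ B}
      (fun w => ENNReal.ofReal (walkWeight G w))
    refine Eq.trans ?_ h3.symm
    congr 1
    ext w
    rw [wt_eq, Set.indicator]
    by_cases hc : ∀ u ∈ w.support.dropLast, u ∉ A ∪ B
    · rw [if_pos hc]
      exact (if_pos hc).symm
    · rw [if_neg hc]
      exact (if_neg hc).symm
  have h0 : ∀ {u w : V} (p : G.Walk u w), 0 ≤ walkWeight G p := by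
    intro u w p
    unfold walkWeight
    apply List.prod_nonneg
    intro a ha
    obtain ⟨b, _, rfl⟩ := List.mem_map.1 ha
    positivity
  rw [h1, ENNReal.tsum_toReal_eq (by simp)]
  unfold hitBefore
  congr 1
  ext γ
  rw [ENNReal.toReal_ofReal (h0 _)]

lemma T_add (S : Set V) (φ ψ : V → ℝ≥0∞) (v : V) :
    T G S (fun v => φ v + ψ v) v = T G S φ v + T G S ψ v := by
  simp [T, Finset.sum_add_distrib, mul_add]

lemma EE_step (S A : Set V) (v : V) :
    EE G S A v = (if v ∈ A then 1 else 0) + T G S (EE G S A) v := by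
  unfold EE
  rw [tsum_eq_zero_add' ENNReal.summable, T_tsum]
  rfl

lemma Gr_step (S : Set V) (v x : V) :
    Gr G S v x = (if v = x then kap G S x else 0) + T G S (fun v => Gr G S v x) v := by
  unfold Gr
  rw [tsum_eq_zero_add' ENNReal.summable, T_tsum]
  rfl

lemma eN_union (S A B : Set V) (h : Disjoint A B) (n : ℕ) (v : V) :
    eN G S (A ∪ B) n v = eN G S A n v + eN G S B n v := by
  induction n generalizing v with
  | zero =>
    have : v ∈ A → v ∉ B := fun h1 => Set.disjoint_left.1 h h1
    simp only [eN, Set.mem_union]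
    by_cases hA : v ∈ A <;> by_cases hB : v ∈ B <;> simp_all
  | succ n ih =>
    simp only [eN]
    rw [← T_add]
    congr 1
    ext w
    exact ih w

lemma EE_union (S A B : Set V) (h : Disjoint A B) (v : V) :
    EE G S (A ∪ B) v = EE G S A v + EE G S B v := by
  unfold EE
  rw [← ENNReal.tsum_add]
  congr 1
  ext n
  exact eN_union G S A B h n v

lemma kN_alt (S : Set V) (n : ℕ) (v w : V) :
    kN G S w (n + 1) v = kap G S w * ∑ u ∈ G.neighborFinset w, kN G S u n v := by
  induction n generalizing v with
  | zero =>
    simp only [kN, T, Finset.sum_ite_eq, Finset.sum_ite_eq', SimpleGraph.mem_neighborFinset,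
      G.adj_comm w v]
    split_ifs <;> simp [mul_comm]
  | succ n ih =>
    rw [kN]
    have : kN G S w (n + 1) = fun v => kap G S w * ∑ u ∈ G.neighborFinset w, kN G S u n v := by
      ext v; exact ih v
    rw [this]
    simp only [T, kN, ← Finset.mul_sum]
    rw [Finset.sum_comm]
    ring

lemma kN_symm (S : Set V) (n : ℕ) (v w : V) : kN G S w n v = kN G S v n w := by
  induction n generalizing v w with
  | zero =>
    simp only [kN, eq_comm (a := w)]
    split_ifs with h
    · rw [h]
    · rfl
  | succ n ih =>
    rw [kN_alt, kN, T]
    simp only [ih]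

lemma Gr_symm (S : Set V) (v w : V) : Gr G S v w = Gr G S w v := by
  unfold Gr
  simp only [kN_symm G S _ v w]

lemma eN_succ (S A : Set V) (n : ℕ) (v : V) :
    eN G S A (n + 1) v = ∑' a : A, ∑ u ∈ G.neighborFinset (a : V), kN G S u n v := by
  induction n generalizing v with
  | zero =>
    rw [← eN_tsum]
    congr 1
    ext a
    simp only [eN, kN, T, Finset.sum_ite_eq, Finset.sum_ite_eq', Set.mem_singleton_iff,
      SimpleGraph.mem_neighborFinset, G.adj_comm v a]
    split_ifs <;> simp
  | succ n ih =>
    rw [eN]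
    have : eN G S A (n + 1) = fun v => ∑' a : A, ∑ u ∈ G.neighborFinset (a : V), kN G S u n v := by
      ext v; exact ih v
    rw [this, T_tsum]
    congr 1
    ext a
    simp only [T, kN, ← Finset.mul_sum]
    rw [Finset.sum_comm]

lemma EE_Gr (S A : Set V) (v : V) :
    EE G S A v = (if v ∈ A then 1 else 0) +
      ∑' a : A, ∑ u ∈ G.neighborFinset (a : V), Gr G S v u := by
  unfold EE Gr
  rw [tsum_eq_zero_add' ENNReal.summable]
  simp only [eN_succ]
  rw [ENNReal.tsum_comm]
  congr 2
  ext a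
  rw [Summable.tsum_finsetSum (fun _ _ => ENNReal.summable)]

lemma tsum_nbr (φ : V → ℝ≥0∞) (v : V) :
    ∑ w ∈ G.neighborFinset v, φ w = ∑' w, if G.Adj v w then φ w else 0 := by
  rw [tsum_eq_sum (s := G.neighborFinset v)]
  · apply Finset.sum_congr rfl
    intro w hw
    simp at hw
    simp [hw]
  · intro w hw
    simp at hw
    simp [hw]

/-- flux symmetry -/
lemma flux_symm (S A B : Set V) :
    ∑' b : B, ∑ w ∈ G.neighborFinset (b : V), EE G S A w =
      ∑' a : A, ∑ w ∈ G.neighborFinset (a : V), EE G S B w := by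
  simp only [EE_Gr, Finset.sum_add_distrib, ENNReal.tsum_add]
  have e1 : ∀ (A B : Set V), ∑' b : B, ∑ w ∈ G.neighborFinset (b : V),
      (if w ∈ A then (1 : ℝ≥0∞) else 0) =
      ∑' (b : B) (a : A), if G.Adj (b : V) a then 1 else 0 := by
    intro A B
    congr 1
    ext b
    rw [tsum_nbr, tsum_subtype A (fun a => if G.Adj (b : V) a then (1 : ℝ≥0∞) else 0)]
    congr 1
    ext w
    simp only [Set.indicator]
    split_ifs <;> simp
  congr 1
  · rw [e1, e1, ENNReal.tsum_comm]
    simp only [G.adj_comm]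
  · have e2 : ∀ (A B : Set V), ∑' b : B, ∑ w ∈ G.neighborFinset (b : V),
      ∑' a : A, ∑ u ∈ G.neighborFinset (a : V), Gr G S w u =
      ∑' (b : B) (a : A), ∑ w ∈ G.neighborFinset (b : V), ∑ u ∈ G.neighborFinset (a : V),
        Gr G S w u := by
      intro A B
      congr 1
      ext b
      rw [Summable.tsum_finsetSum (fun _ _ => ENNReal.summable)]
    rw [e2, e2, ENNReal.tsum_comm]
    congr 1
    ext a
    congr 1
    ext b
    rw [Finset.sum_comm]
    simp only [Gr_symm G S]

lemma T_mono (S : Set V) {φ ψ : V → ℝ≥0∞} (h : ∀ v, φ v ≤ ψ v) (v : V) :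
    T G S φ v ≤ T G S ψ v := by
  unfold T
  gcongr
  exact h _

lemma cc_mul (v : V) (hd : 0 < G.degree v) : cc G v * (G.degree v : ℝ≥0∞) = 1 := by
  unfold cc
  rw [← ENNReal.ofReal_natCast, ← ENNReal.ofReal_mul (by positivity), inv_mul_cancel₀ (by positivity)]
  simp

lemma T_const (S : Set V) (M : ℝ≥0∞) (v : V) (hd : 0 < G.degree v) :
    T G S (fun _ => M) v ≤ M := by
  unfold T kap
  split_ifs
  · simp
  · rw [Finset.sum_const, nsmul_eq_mul, G.card_neighborFinset_eq_degree, ← mul_assoc, cc_mul G v hd,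
      one_mul]

lemma kN_sum_le (S : Set V) (x : V) (hd : ∀ v, 0 < G.degree v) (n : ℕ) (v : V) :
    ∑ k ∈ Finset.range n, kN G S x k v ≤ Gr G S x x := by
  induction n generalizing v with
  | zero => simp
  | succ n ih =>
    by_cases h : v = x
    · subst h
      exact ENNReal.sum_le_tsum _
    · rw [Finset.sum_range_succ']
      have h0 : kN G S x 0 v = 0 := by simp [kN, h]
      rw [h0, add_zero]
      have : ∑ k ∈ Finset.range n, kN G S x (k + 1) v =
          T G S (fun v => ∑ k ∈ Finset.range n, kN G S x k v) v := by
        simp only [kN, T, ← Finset.mul_sum]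
        rw [Finset.sum_comm]
      rw [this]
      exact (T_mono G S ih v).trans (T_const G S _ v (hd v))

lemma Gr_le (S : Set V) (x : V) (hd : ∀ v, 0 < G.degree v) (v : V) :
    Gr G S v x ≤ Gr G S x x :=
  ENNReal.tsum_le_of_sum_range_le (fun n => kN_sum_le G S x hd n v)

lemma T_mem (S : Set V) (φ : V → ℝ≥0∞) (v : V) (h : v ∈ S) : T G S φ v = 0 := by
  simp [T, kap, h]

lemma EE_mem (S A : Set V) (v : V) (h : v ∈ S) : EE G S A v = if v ∈ A then 1 else 0 := by
  rw [EE_step, T_mem G S _ v h, add_zero]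

lemma Gr_mem (S : Set V) (x v : V) (h : v ∈ S) : Gr G S v x = 0 := by
  rw [Gr_step, T_mem G S _ v h, add_zero]
  split_ifs with hh
  · subst hh; simp [kap, h]
  · rfl

lemma Gr_ne_top (S A : Set V) (hAS : A ⊆ S) (x : V) (hx : x ∉ S)
    (hd : ∀ v, 0 < G.degree v) (hE : EE G S A x ≠ ⊤) (hE0 : EE G S A x ≠ 0) :
    Gr G S x x ≠ ⊤ := by
  intro htop
  apply hE0
  have key : ∀ n v, v ∉ S → Gr G S v x = ⊤ → eN G S A n v = 0 := by
    intro n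
    induction n with
    | zero =>
      intro v hv _
      have : v ∉ A := fun h => hv (hAS h)
      simp [eN, this]
    | succ n ih =>
      intro v hv hP
      rw [eN, T]
      refine mul_eq_zero_of_right _ (Finset.sum_eq_zero fun w hw => ?_)
      have hvw : G.Adj v w := by simpa using hw
      by_cases hwS : w ∈ S
      · cases n with
        | succ n => exact T_mem G S _ w hwS
        | zero =>
          by_cases hwA : w ∈ A
          · exfalso
            apply hE
            rw [eq_top_iff, ← hP, EE_Gr]
            refine le_trans ?_ le_add_self
            refine le_trans ?_ (ENNReal.le_tsum (⟨w, hwA⟩ : A))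
            rw [Gr_symm]
            exact Finset.single_le_sum (f := fun u => Gr G S x u) (fun _ _ => zero_le)
              (by simpa using hvw.symm)
          · simp [eN, hwA]
      · apply ih w hwS
        rw [Gr_step, T, eq_top_iff]
        refine le_trans ?_ le_add_self
        have h1 : kap G S w ≠ 0 := by
          have := hd w
          simp only [kap, hwS, if_false, cc]
          simpa using this.ne'
        have h2 : ∑ u ∈ G.neighborFinset w, Gr G S u x = ⊤ := by
          rw [eq_top_iff, ← hP]
          exact Finset.single_le_sum (f := fun u => Gr G S u x) (fun _ _ => zero_le)
              (by simpa using hvw.symm)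
        rw [h2, ENNReal.mul_top h1]
  unfold EE
  rw [ENNReal.tsum_eq_zero]
  intro n
  exact key n x hx htop

lemma lap_eq (φ : V → ℝ) (v : V) :
    graphLap G φ v = ∑ w ∈ G.neighborFinset v, φ w - G.degree v * φ v := by
  simp [graphLap, Finset.sum_sub_distrib]

lemma lap_toReal (S : Set V) (φ : V → ℝ≥0∞) (hφ : ∀ v, φ v ≠ ⊤) (d : ℝ≥0∞) (hd' : d ≠ ⊤) (v : V)
    (hv : v ∉ S) (hd : 0 < G.degree v) (h : φ v = kap G S v * d + T G S φ v) :
    graphLap G (fun v => (φ v).toReal) v = - d.toReal := by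
  have h1 : (φ v).toReal = (G.degree v : ℝ)⁻¹ * (d.toReal + ∑ w ∈ G.neighborFinset v, (φ w).toReal) := by
    conv_lhs => rw [h]
    rw [T, ← mul_add, ENNReal.toReal_mul, ENNReal.toReal_add hd'
      (ENNReal.sum_ne_top.2 fun w _ => hφ w), ENNReal.toReal_sum fun w _ => hφ w]
    simp [kap, hv, cc]
  have h2 : (G.degree v : ℝ) ≠ 0 := by positivity
  rw [lap_eq, h1]
  field_simp
  ring

lemma zero_of_harm (S : Set V) (hd : ∀ v, 0 < G.degree v)
    (hE : ∀ v, EE G S S v = 1) (d : V → ℝ) (hb : ∃ M : ℝ, ∀ v, |d v| ≤ M)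
    (h0 : ∀ v ∈ S, d v = 0) (hh : ∀ v, v ∉ S → graphLap G d v = 0) (v : V) : d v = 0 := by
  obtain ⟨M, hM⟩ := hb
  have key : ∀ n v, ENNReal.ofReal |d v| + ENNReal.ofReal M * ∑ k ∈ Finset.range n, eN G S S k v
      ≤ ENNReal.ofReal M := by
    intro n
    induction n with
    | zero => intro v; simpa using ENNReal.ofReal_le_ofReal (hM v)
    | succ n ih =>
      intro v
      by_cases hv : v ∈ S
      · have : ∑ k ∈ Finset.range (n+1), eN G S S k v ≤ 1 := by
          rw [← hE v]; exact ENNReal.sum_le_tsum _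
        rw [h0 v hv]
        simpa using mul_le_mul_right this (ENNReal.ofReal M)
      · have e1 : ∑ k ∈ Finset.range (n+1), eN G S S k v =
            T G S (fun v => ∑ k ∈ Finset.range n, eN G S S k v) v := by
          rw [Finset.sum_range_succ']
          simp only [eN, T, ← Finset.mul_sum, hv, if_false, add_zero]
          rw [Finset.sum_comm]
        have e2 : ENNReal.ofReal |d v| ≤ T G S (fun v => ENNReal.ofReal |d v|) v := by
          have h3 := hh v hv
          rw [lap_eq, sub_eq_zero] at h3
          have h4 : 0 < (G.degree v : ℝ) := by exact_mod_cast hd v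
          have h5 : |d v| ≤ (G.degree v : ℝ)⁻¹ * ∑ w ∈ G.neighborFinset v, |d w| := by
            rw [inv_mul_eq_div, le_div_iff₀ h4]
            calc |d v| * G.degree v = |∑ w ∈ G.neighborFinset v, d w| := by
                  rw [h3, abs_mul, abs_of_pos h4, mul_comm]
              _ ≤ _ := Finset.abs_sum_le_sum_abs _ _
          refine (ENNReal.ofReal_le_ofReal h5).trans ?_
          rw [ENNReal.ofReal_mul (by positivity), ENNReal.ofReal_sum_of_nonneg (fun _ _ => abs_nonneg _)]
          simp [T, kap, cc, hv]
        calc _ ≤ T G S (fun v => ENNReal.ofReal |d v|) v +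
              T G S (fun v => ENNReal.ofReal M * ∑ k ∈ Finset.range n, eN G S S k v) v := by
                refine add_le_add e2 (le_of_eq ?_)
                rw [e1]
                simp only [T, ← Finset.mul_sum]
                ring
          _ ≤ T G S (fun _ => ENNReal.ofReal M) v := by
                rw [← T_add]
                exact T_mono G S ih v
          _ ≤ _ := T_const G S _ v (hd v)
  have lim : ENNReal.ofReal |d v| + ENNReal.ofReal M * EE G S S v ≤ ENNReal.ofReal M := by
    have ht : Tendsto (fun n => ENNReal.ofReal |d v| +
        ENNReal.ofReal M * ∑ k ∈ Finset.range n, eN G S S k v) atTop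
        (nhds (ENNReal.ofReal |d v| + ENNReal.ofReal M * EE G S S v)) := by
      refine Tendsto.add tendsto_const_nhds ?_
      exact ENNReal.Tendsto.const_mul (ENNReal.tendsto_nat_tsum _) (Or.inr ENNReal.ofReal_ne_top)
    exact le_of_tendsto' ht (fun n => key n v)
  rw [hE, mul_one] at lim
  have : ENNReal.ofReal |d v| = 0 := by
    by_contra hne
    have := ENNReal.lt_add_right (a := ENNReal.ofReal M) ENNReal.ofReal_ne_top hne
    rw [add_comm] at this
    exact absurd lim (not_le.2 this)
  simpa using this

lemma hasSum_real (A : Set V) (φ : V → ℝ≥0∞) (hφ : ∀ v, φ v ≠ ⊤)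
    (h : ∑' a : A, ∑ w ∈ G.neighborFinset (a : V), φ w ≠ ⊤) :
    HasSum (fun a : A => ∑ w ∈ G.neighborFinset (a : V), (φ w).toReal)
      (∑' a : A, ∑ w ∈ G.neighborFinset (a : V), φ w).toReal := by
  have := ENNReal.hasSum_toReal h
  rw [ENNReal.tsum_toReal_eq (fun a => ENNReal.sum_ne_top.2 fun w _ => hφ w)]
  simp only [ENNReal.toReal_sum (fun w _ => hφ w)] at this ⊢
  exact this

lemma lap_lin (f h : V → ℝ) (c : ℝ) (v : V) :
    graphLap G (fun v => f v + c * h v) v = graphLap G f v + c * graphLap G h v := by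
  simp only [lap_eq, Finset.sum_add_distrib, ← Finset.mul_sum]
  ring

end RW

/-- With `L(A,B) = Σ_{v∈B} Δ_G f(v) < ∞` and `x ∈ C` with `f(x) > 0`, there is a unique
bounded `g` with `g ≡ 1` on `A`, `g ≡ 0` on `B`, `Δ_G g ≡ 0` on `C \ {x}`, and
`Σ_{v∈A} Δ_G g(v) = 0`; moreover `g ≥ 0`, `Σ_{v∈B∪{x}} Δ_G g(v) = 0`, and
`Δ_G g(x) = −L(A,B)/f(x)`. -/
theorem stmt13 {V : Type*} (G : SimpleGraph V) [G.LocallyFinite]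
    (hconn : G.Connected) (A B : Set V) (hAB : Disjoint A B)
    (hreach : ∀ v : V, v ∉ A ∪ B → hitBefore G (A ∪ B) ∅ v = 1)
    (hL : Summable fun v : B => graphLap G (hitBefore G A B) v)
    (x : V) (hx : x ∉ A ∪ B) (hfx : 0 < hitBefore G A B x) :
    ∃ g : V → ℝ,
      ((∃ M : ℝ, ∀ v : V, |g v| ≤ M) ∧ (∀ v ∈ A, g v = 1) ∧ (∀ v ∈ B, g v = 0) ∧
        (∀ v : V, v ∉ A ∪ B → v ≠ x → graphLap G g v = 0) ∧
        (∑' v : A, graphLap G g v) = 0) ∧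
      (∀ g' : V → ℝ,
        ((∃ M : ℝ, ∀ v : V, |g' v| ≤ M) ∧ (∀ v ∈ A, g' v = 1) ∧ (∀ v ∈ B, g' v = 0) ∧
          (∀ v : V, v ∉ A ∪ B → v ≠ x → graphLap G g' v = 0) ∧
          (∑' v : A, graphLap G g' v) = 0) → g' = g) ∧
      (∀ v : V, 0 ≤ g v) ∧
      (∑' v : (B ∪ {x} : Set V), graphLap G g v) = 0 ∧
      graphLap G g x =
        -(∑' v : B, graphLap G (hitBefore G A B) v) / hitBefore G A B x := by
  classical
  have hdx : ∀ v, 0 < G.degree v := by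
    have hA : ∃ a, a ∈ A := by
      by_contra hne
      push Not at hne
      have : IsEmpty A := ⟨fun a => hne a a.2⟩
      simp [hitBefore] at hfx
    obtain ⟨a, ha⟩ := hA
    have : Nontrivial V := ⟨a, x, fun h => hx (h ▸ Or.inl ha)⟩
    intro v
    exact hconn.preconnected.degree_pos_of_nontrivial v
  set S := A ∪ B with hS
  have hES : ∀ v, RW.EE G S S v = 1 := by
    intro v
    by_cases hv : v ∈ S
    · rw [RW.EE_mem G S S v hv, if_pos hv]
    · have := hreach v hv
      rw [RW.hit_eq, Set.union_empty] at this
      exact (ENNReal.toReal_eq_one_iff _).1 this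
  have hsum : ∀ v, RW.EE G S A v + RW.EE G S B v = 1 := by
    intro v
    rw [← RW.EE_union G S A B hAB, ← hS, hES]
  have hAt : ∀ v, RW.EE G S A v ≠ ⊤ := fun v h => by simpa [h] using hsum v
  have hBt : ∀ v, RW.EE G S B v ≠ ⊤ := fun v h => by simpa [h] using hsum v
  have hf : hitBefore G A B = fun v => (RW.EE G S A v).toReal := by
    ext v; exact RW.hit_eq G A B v
  rw [hf] at hL hfx ⊢
  set f : V → ℝ := fun v => (RW.EE G S A v).toReal with hfdef
  have hfB : ∀ v, (RW.EE G S B v).toReal = 1 - f v := by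
    intro v
    have := congrArg ENNReal.toReal (hsum v)
    rw [ENNReal.toReal_add (hAt v) (hBt v)] at this
    simp only [hfdef]
    simp at this
    linarith
  have hf0 : ∀ v, 0 ≤ f v := fun v => ENNReal.toReal_nonneg
  have hf1 : ∀ v, f v ≤ 1 := fun v => by
    have : 0 ≤ (RW.EE G S B v).toReal := ENNReal.toReal_nonneg
    rw [hfB] at this; linarith
  have hfA1 : ∀ v ∈ A, f v = 1 := fun v hv => by
    simp [hfdef, RW.EE_mem G S A v (Or.inl hv), hv]
  have hfB0 : ∀ v ∈ B, f v = 0 := fun v hv => by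
    simp [hfdef, RW.EE_mem G S A v (Or.inr hv), Set.disjoint_right.1 hAB hv]
  have hfh : ∀ v, v ∉ S → graphLap G f v = 0 := by
    intro v hv
    have := RW.lap_toReal G S (RW.EE G S A) hAt 0 (by simp) v hv (hdx v) (by
      conv_lhs => rw [RW.EE_step]
      have : v ∉ A := fun h => hv (Or.inl h)
      simp [this])
    simpa using this
  -- Green function
  have hGxx : RW.Gr G S x x ≠ ⊤ := RW.Gr_ne_top G S A Set.subset_union_left x hx hdx (hAt x) (by
    intro h0
    simp [hfdef, h0] at hfx)
  have hGt : ∀ v, RW.Gr G S v x ≠ ⊤ := fun v => ne_top_of_le_ne_top hGxx (RW.Gr_le G S x hdx v)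
  set h : V → ℝ := fun v => (RW.Gr G S v x).toReal with hhdef
  have hh0 : ∀ v, 0 ≤ h v := fun v => ENNReal.toReal_nonneg
  have hhle : ∀ v, h v ≤ h x := fun v => ENNReal.toReal_mono hGxx (RW.Gr_le G S x hdx v)
  have hhS : ∀ v ∈ S, h v = 0 := fun v hv => by simp [hhdef, RW.Gr_mem G S x v hv]
  have hhx : graphLap G h x = -1 := by
    have := RW.lap_toReal G S (fun v => RW.Gr G S v x) hGt 1 (by simp) x hx (hdx x) (by
      conv_lhs => rw [RW.Gr_step]
      simp)
    simpa using this
  have hhh : ∀ v, v ∉ S → v ≠ x → graphLap G h v = 0 := by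
    intro v hv hvx
    have := RW.lap_toReal G S (fun v => RW.Gr G S v x) hGt 0 (by simp) v hv (hdx v) (by
      conv_lhs => rw [RW.Gr_step]
      simp [hvx])
    simpa using this
  -- fluxes of `h`
  have flux : ∀ D : Set V, D ⊆ S → RW.EE G S D x ≠ ⊤ →
      HasSum (fun a : D => graphLap G h a) (RW.EE G S D x).toReal := by
    intro D hD hDt
    have hxD : x ∉ D := fun hxx => hx (hD hxx)
    have e := RW.EE_Gr G S D x
    rw [if_neg hxD, zero_add] at e
    simp only [RW.Gr_symm G S x] at e
    rw [e] at hDt ⊢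
    have := RW.hasSum_real G D (fun v => RW.Gr G S v x) hGt hDt
    convert this using 2 with a
    rw [RW.lap_eq, hhS a (hD a.2)]
    simp [hhdef]
  have fluxA := flux A Set.subset_union_left (hAt x)
  have fluxB := flux B Set.subset_union_right (hBt x)
  rw [hfB x] at fluxB
  change HasSum _ (f x) at fluxA
  -- fluxes of `f`
  have lapB : ∀ b : B, graphLap G f b = ∑ w ∈ G.neighborFinset (b : V), f w := by
    intro b
    rw [RW.lap_eq, hfB0 b b.2]; simp
  have hLt : ∑' b : B, ∑ w ∈ G.neighborFinset (b : V), RW.EE G S A w ≠ ⊤ := by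
    have e : ∀ b : B, ∑ w ∈ G.neighborFinset (b : V), RW.EE G S A w =
        ENNReal.ofReal (graphLap G f b) := by
      intro b
      rw [lapB, ENNReal.ofReal_sum_of_nonneg (fun w _ => hf0 w)]
      refine Finset.sum_congr rfl fun w _ => ?_
      rw [hfdef, ENNReal.ofReal_toReal (hAt w)]
    simp only [e]
    exact hL.tsum_ofReal_ne_top
  have ffB : HasSum (fun b : B => graphLap G f b)
      (∑' b : B, ∑ w ∈ G.neighborFinset (b : V), RW.EE G S A w).toReal := by
    simp only [lapB]
    exact RW.hasSum_real G B _ hAt hLt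
  have ffA : HasSum (fun a : A => graphLap G f a)
      (-(∑' b : B, ∑ w ∈ G.neighborFinset (b : V), RW.EE G S A w).toReal) := by
    rw [RW.flux_symm] at hLt ⊢
    have := (RW.hasSum_real G A _ hBt hLt).neg
    refine (congrArg (fun F : A → ℝ => HasSum F _) (funext fun a => ?_)).mpr this
    rw [Finset.sum_congr rfl (fun w _ => hfB w)]
    rw [graphLap, hfA1 a a.2, ← Finset.sum_neg_distrib]
    refine Finset.sum_congr rfl fun w _ => ?_
    ring
  rw [ffB.tsum_eq]
  set L : ℝ := (∑' b : B, ∑ w ∈ G.neighborFinset (b : V), RW.EE G S A w).toReal with hLdef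
  have hL0 : 0 ≤ L := ENNReal.toReal_nonneg
  have hc0 : 0 ≤ L / f x := div_nonneg hL0 hfx.le
  have hlinA : ∀ c : ℝ, HasSum (fun a : A => graphLap G (fun v => f v + c * h v) a) (-L + c * f x) := by
    intro c
    simp only [RW.lap_lin]
    exact ffA.add (fluxA.mul_left c)
  have hlinB : ∀ c : ℝ, HasSum (fun a : B => graphLap G (fun v => f v + c * h v) a)
      (L + c * (1 - f x)) := by
    intro c
    simp only [RW.lap_lin]
    exact ffB.add (fluxB.mul_left c)
  refine ⟨fun v => f v + L / f x * h v, ⟨⟨1 + L / f x * h x, ?_⟩, ?_, ?_, ?_, ?_⟩, ?_, ?_, ?_, ?_⟩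
  · intro v
    rw [abs_of_nonneg (add_nonneg (hf0 v) (mul_nonneg hc0 (hh0 v)))]
    exact add_le_add (hf1 v) (mul_le_mul_of_nonneg_left (hhle v) hc0)
  · intro v hv
    simp [hfA1 v hv, hhS v (Or.inl hv)]
  · intro v hv
    simp [hfB0 v hv, hhS v (Or.inr hv)]
  · intro v hv hvx
    rw [RW.lap_lin, hfh v hv, hhh v hv hvx]; simp
  · rw [(hlinA _).tsum_eq, div_mul_cancel₀ _ hfx.ne']; simp
  · rintro g' ⟨⟨M, hM⟩, hgA, hgB, hgh, hgs⟩
    set c : ℝ := -graphLap G g' x with hc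
    have hg : g' = fun v => f v + c * h v := by
      have hz := RW.zero_of_harm G S hdx hES (fun v => g' v + (-1) * (f v + c * h v))
        ⟨M + (1 + |c| * h x), fun v => by
          have h1 := hM v
          have h2 : |(-1) * (f v + c * h v)| ≤ 1 + |c| * h x := by
            rw [abs_mul, abs_neg, abs_one, one_mul]
            refine (abs_add_le _ _).trans ?_
            rw [abs_mul, abs_of_nonneg (hf0 v), abs_of_nonneg (hh0 v)]
            exact add_le_add (hf1 v) (mul_le_mul_of_nonneg_left (hhle v) (abs_nonneg c))
          exact (abs_add_le _ _).trans (add_le_add h1 h2)⟩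
        (by
          intro v hv
          show g' v + (-1) * (f v + c * h v) = 0
          rw [hhS v hv]
          rcases hv with hv | hv
          · rw [hgA v hv, hfA1 v hv]; ring
          · rw [hgB v hv, hfB0 v hv]; ring)
        (by
          intro v hv
          rw [RW.lap_lin, RW.lap_lin, hfh v hv]
          by_cases hvx : v = x
          · rw [hvx, hhx, hc]; ring
          · rw [hgh v hv hvx, hhh v hv hvx]; ring)
      ext v
      have := hz v
      linarith
    rw [hg, (hlinA c).tsum_eq] at hgs
    have : c = L / f x := by
      rw [eq_div_iff hfx.ne']; linarith
    rw [← this]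
    exact hg
  · intro v
    exact add_nonneg (hf0 v) (mul_nonneg hc0 (hh0 v))
  · have hd : Disjoint B {x} := by
      rw [Set.disjoint_singleton_right]
      exact fun hxB => hx (Or.inr hxB)
    have hxs : HasSum (fun v : ({x} : Set V) => graphLap G (fun v => f v + L / f x * h v) v)
        (-(L / f x)) := by
      have := hasSum_unique (fun v : ({x} : Set V) => graphLap G (fun v => f v + L / f x * h v) v)
      convert this using 1
      show _ = graphLap G (fun v => f v + L / f x * h v) x
      rw [RW.lap_lin, hfh x hx, hhx]; ring
    have := HasSum.add_disjoint (f := graphLap G (fun v => f v + L / f x * h v)) hd (hlinB _) hxs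
    have h2 := this.tsum_eq
    refine Eq.trans h2 ?_
    field_simp
    ring
  · rw [RW.lap_lin, hfh x hx, hhx]; ring
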